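/- arXiv:1410.6072 — 2 statements merged into one kernel-verified Lean document; each statement's English description precedes it below -/
import Mathlib

section
/- For every A ∈ ℝ^{n₁×⋯×n_d} and every r ∈ ℕ, the best nuclear rank-r approximation problem min{ ‖A − X‖ : X ∈ ℝ^{n₁×⋯×n_d}, rank_*(X) ≤ r } has a solution, i.e., the minimum is attained by some X with rank_*(X) ≤ r. -/
open scoped BigOperators

noncomputable section

/-- The outer (tensor) product of vectors `x k ∈ ℝ^{n k}`, giving the rank-one tensor
with entries `∏ k, (x k) (i k)`. -/
def rankOne {ι : Type} [Fintype ι] {n : ι → ℕ}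
    (x : (k : ι) → EuclideanSpace ℝ (Fin (n k))) : ((k : ι) → Fin (n k)) → ℝ :=
  fun i => ∏ k, x k (i k)

/-- The Hilbert–Schmidt norm of a tensor. -/
def hsNorm {ι : Type} [Fintype ι] [DecidableEq ι] {n : ι → ℕ}
    (A : ((k : ι) → Fin (n k)) → ℝ) : ℝ :=
  Real.sqrt (∑ i, ‖A i‖ ^ 2)

/-- The nuclear norm of a tensor. -/
def nucNorm {ι : Type} [Fintype ι] [DecidableEq ι] {n : ι → ℕ}
    (A : ((k : ι) → Fin (n k)) → ℝ) : ℝ :=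
  sInf { s : ℝ | ∃ (r : ℕ) (x : Fin r → (k : ι) → EuclideanSpace ℝ (Fin (n k))),
    A = (∑ i, rankOne (x i)) ∧ s = ∑ i, ∏ k, ‖x i k‖ }

/-- The nuclear rank of a tensor: the least number of rank-one terms in a decomposition
attaining the nuclear norm. -/
noncomputable def tNuclearRank {ι : Type} [Fintype ι] [DecidableEq ι] {n : ι → ℕ}
    (A : ((k : ι) → Fin (n k)) → ℝ) : ℕ :=
  sInf { r : ℕ | ∃ x : Fin r → (k : ι) → EuclideanSpace ℝ (Fin (n k)),
    A = (∑ i, rankOne (x i)) ∧ nucNorm A = ∑ i, ∏ k, ‖x i k‖ }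

/-- `HasDecomp κ A s` says that `A` is a sum of rank-one tensors indexed by `κ` whose norms
add up to `s`. -/
def HasDecomp {ι : Type} [Fintype ι] {n : ι → ℕ} (κ : Type*) [Fintype κ]
    (A : ((k : ι) → Fin (n k)) → ℝ) (s : ℝ) : Prop :=
  ∃ x : κ → (k : ι) → EuclideanSpace ℝ (Fin (n k)),
    A = (∑ i, rankOne (x i)) ∧ s = ∑ i, ∏ k, ‖x i k‖

section Decompositions

open Filter Topology

variable {ι : Type} [Fintype ι] {n : ι → ℕ}

lemma abs_rankOne_le (x : (k : ι) → EuclideanSpace ℝ (Fin (n k))) (i : (k : ι) → Fin (n k)) :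
    |rankOne x i| ≤ ∏ k, ‖x k‖ := by
  rw [rankOne, Finset.abs_prod]
  exact Finset.prod_le_prod (fun _ _ => abs_nonneg _) fun k _ => PiLp.norm_apply_le (x k) (i k)

lemma rankOne_smul_family (c : ι → ℝ) (x : (k : ι) → EuclideanSpace ℝ (Fin (n k))) :
    rankOne (fun k => c k • x k) = (∏ k, c k) • rankOne x := by
  ext i
  simp [rankOne, Finset.prod_mul_distrib]

lemma continuous_rankOne :
    Continuous (rankOne : ((k : ι) → EuclideanSpace ℝ (Fin (n k))) → _) := by
  unfold rankOne
  fun_prop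

lemma exists_rankOne_eq_smul [Nonempty ι] (c : ℝ)
    (x : (k : ι) → EuclideanSpace ℝ (Fin (n k))) :
    ∃ y : (k : ι) → EuclideanSpace ℝ (Fin (n k)),
      rankOne y = c • rankOne x ∧ ∏ k, ‖y k‖ = |c| * ∏ k, ‖x k‖ := by
  classical
  obtain ⟨k₀⟩ := ‹Nonempty ι›
  have hc : ∏ k, (if k = k₀ then c else 1) = c := by simp
  refine ⟨fun k => (if k = k₀ then c else 1) • x k, ?_, ?_⟩
  · rw [rankOne_smul_family, hc]
  · simp only [norm_smul, Finset.prod_mul_distrib, Real.norm_eq_abs]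
    rw [← Finset.abs_prod, hc]

lemma rankOne_zero [Nonempty ι] :
    rankOne (0 : (k : ι) → EuclideanSpace ℝ (Fin (n k))) = 0 := by
  ext i
  simp [rankOne]

/-- The factors of a rank-one tensor can be rescaled to have equal norms. -/
lemma exists_balanced [Nonempty ι] (x : (k : ι) → EuclideanSpace ℝ (Fin (n k))) :
    ∃ y : (k : ι) → EuclideanSpace ℝ (Fin (n k)),
      rankOne y = rankOne x ∧ ∏ k, ‖y k‖ = ∏ k, ‖x k‖ ∧ ∀ k, ‖y k‖ ≤ 1 + ∏ k, ‖x k‖ := by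
  have hd : Fintype.card ι ≠ 0 := Fintype.card_ne_zero
  have hP : 0 ≤ ∏ k, ‖x k‖ := Finset.prod_nonneg fun _ _ => norm_nonneg _
  by_cases h : ∃ k, x k = 0
  · obtain ⟨k, hk⟩ := h
    have h0 : ∏ k, ‖x k‖ = 0 := Finset.prod_eq_zero (Finset.mem_univ k) (by simp [hk])
    refine ⟨0, ?_, ?_, ?_⟩
    · rw [rankOne_zero]
      ext i
      have := abs_rankOne_le x i
      rw [h0] at this
      simpa using (abs_nonpos_iff.1 this).symm
    · rw [h0]
      simp
    · simpa using add_nonneg zero_le_one hP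
  · push Not at h
    obtain ⟨t, ht, htP⟩ : ∃ t : ℝ, 0 ≤ t ∧ t ^ Fintype.card ι = ∏ k, ‖x k‖ :=
      ⟨_, Real.rpow_nonneg hP _, Real.rpow_inv_natCast_pow hP hd⟩
    have hpos : ∏ k, ‖x k‖ ≠ 0 := Finset.prod_ne_zero_iff.2 fun k _ => norm_ne_zero_iff.2 (h k)
    have hy : ∀ k, ‖(t / ‖x k‖) • x k‖ = t := fun k => by
      rw [norm_smul, Real.norm_eq_abs, abs_of_nonneg (by positivity)]
      exact div_mul_cancel₀ _ (norm_ne_zero_iff.2 (h k))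
    refine ⟨fun k => (t / ‖x k‖) • x k, ?_, ?_, ?_⟩
    · rw [rankOne_smul_family, Finset.prod_div_distrib]
      simp [htP, div_self hpos]
    · simp [hy, htP]
    · intro k
      rw [hy, ← htP]
      rcases le_total t 1 with h1 | h1
      · linarith [pow_nonneg ht (Fintype.card ι)]
      · linarith [le_self_pow₀ h1 hd]

lemma HasDecomp.nonneg {κ : Type*} [Fintype κ] {A : ((k : ι) → Fin (n k)) → ℝ} {s : ℝ}
    (h : HasDecomp κ A s) : 0 ≤ s := by
  obtain ⟨x, -, rfl⟩ := h
  positivity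

lemma HasDecomp.eq_zero {κ : Type*} [Fintype κ] {A : ((k : ι) → Fin (n k)) → ℝ}
    (h : HasDecomp κ A 0) : A = 0 := by
  obtain ⟨x, rfl, hx⟩ := h
  ext i
  rw [Finset.sum_apply]
  refine Finset.sum_eq_zero fun j _ => abs_nonpos_iff.1 ((abs_rankOne_le (x j) i).trans ?_)
  rw [hx]
  exact Finset.single_le_sum (f := fun j => ∏ k, ‖x j k‖)
    (fun _ _ => Finset.prod_nonneg fun _ _ => norm_nonneg _) (Finset.mem_univ j)

lemma HasDecomp.congr {κ μ : Type*} [Fintype κ] [Fintype μ]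
    {A : ((k : ι) → Fin (n k)) → ℝ} {s : ℝ} (e : μ ≃ κ) (h : HasDecomp κ A s) :
    HasDecomp μ A s := by
  obtain ⟨x, rfl, rfl⟩ := h
  exact ⟨x ∘ e, (e.sum_comp fun i => rankOne (x i)).symm,
    (e.sum_comp fun i => ∏ k, ‖x i k‖).symm⟩

lemma HasDecomp.add {κ μ : Type*} [Fintype κ] [Fintype μ]
    {A B : ((k : ι) → Fin (n k)) → ℝ} {s t : ℝ} (hA : HasDecomp κ A s) (hB : HasDecomp μ B t) :
    HasDecomp (κ ⊕ μ) (A + B) (s + t) := by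
  obtain ⟨x, rfl, rfl⟩ := hA
  obtain ⟨y, rfl, rfl⟩ := hB
  exact ⟨Sum.elim x y, by simp, by simp⟩

lemma hasDecomp_zero [Nonempty ι] (κ : Type*) [Fintype κ] :
    HasDecomp κ (0 : ((k : ι) → Fin (n k)) → ℝ) 0 :=
  ⟨fun _ => 0, by simp [rankOne_zero], by simp⟩

lemma HasDecomp.fin_of_card_le [Nonempty ι] {κ : Type*} [Fintype κ]
    {A : ((k : ι) → Fin (n k)) → ℝ} {s : ℝ} (h : HasDecomp κ A s) {r : ℕ}
    (hr : Fintype.card κ ≤ r) : HasDecomp (Fin r) A s := by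
  have h' := h.add (hasDecomp_zero (Fin (r - Fintype.card κ)))
  rw [add_zero, add_zero] at h'
  exact h'.congr (Fintype.equivOfCardEq (by simp [hr]))

/-- Splitting a tensor into its entries is a decomposition whose cost is the `ℓ¹` norm. -/
lemma hasDecomp_entries [Nonempty ι] [DecidableEq ι] (A : ((k : ι) → Fin (n k)) → ℝ) :
    HasDecomp ((k : ι) → Fin (n k)) A (∑ i, |A i|) := by
  choose y hy hy' using fun i : (k : ι) → Fin (n k) =>
    exists_rankOne_eq_smul (A i) (fun k => EuclideanSpace.single (i k) (1 : ℝ))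
  refine ⟨y, ?_, by simp [hy']⟩
  ext j
  rw [Finset.sum_apply, Finset.sum_eq_single j]
  · rw [hy]
    simp [rankOne]
  · intro i _ hij
    obtain ⟨k, hk⟩ := Function.ne_iff.1 hij
    rw [hy, Pi.smul_apply, rankOne, Finset.prod_eq_zero (Finset.mem_univ k), smul_zero]
    simp [hk.symm]
  · simp

/-- Carathéodory's theorem for decompositions: the number of terms can be bounded uniformly
without increasing the cost. -/
lemma HasDecomp.exists_fin_le [Nonempty ι] [DecidableEq ι] {κ : Type} [Fintype κ]
    {A : ((k : ι) → Fin (n k)) → ℝ} {s : ℝ} (h : HasDecomp κ A s) :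
    ∃ t ≤ s, HasDecomp (Fin (Module.finrank ℝ (((k : ι) → Fin (n k)) → ℝ) + 1)) A t := by
  rcases h.nonneg.eq_or_lt with rfl | hs
  · rw [h.eq_zero]
    exact ⟨0, le_rfl, hasDecomp_zero _⟩
  obtain ⟨x, hA, hx⟩ := h
  set P : κ → ℝ := fun i => ∏ k, ‖x i k‖ with hP
  have hP0 : ∀ i, 0 ≤ P i := fun i => Finset.prod_nonneg fun _ _ => norm_nonneg _
  have hmem : A ∈ convexHull ℝ {X | ∃ y : (k : ι) → EuclideanSpace ℝ (Fin (n k)),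
      rankOne y = X ∧ ∏ k, ‖y k‖ ≤ s} := by
    refine mem_convexHull_of_exists_fintype (fun i => P i / s)
      (fun i => (s / P i) • rankOne (x i)) (fun i => div_nonneg (hP0 i) hs.le) ?_ ?_ ?_
    · rw [← Finset.sum_div, ← hx, div_self hs.ne']
    · intro i
      obtain ⟨y, hy, hy'⟩ := exists_rankOne_eq_smul (s / P i) (x i)
      refine ⟨y, hy, ?_⟩
      rw [hy', abs_of_nonneg (div_nonneg hs.le (hP0 i))]
      rcases (hP0 i).eq_or_lt with h0 | h0
      · rw [← h0]
        simpa using hs.le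
      · exact (div_mul_cancel₀ s h0.ne').le
    · rw [hA]
      refine Finset.sum_congr rfl fun i _ => ?_
      rw [smul_smul]
      rcases (hP0 i).eq_or_lt with h0 | h0
      · have : rankOne (x i) = 0 := by
          ext j
          exact abs_nonpos_iff.1 ((abs_rankOne_le (x i) j).trans h0.ge)
        simp [this]
      · rw [show P i / s * (s / P i) = 1 by field_simp, one_smul]
  obtain ⟨μ, _, z, w, hz, hind, hw, hw1, hsum⟩ := eq_pos_convex_span_of_mem_convexHull hmem
  have hcard : Fintype.card μ ≤ Module.finrank ℝ (((k : ι) → Fin (n k)) → ℝ) + 1 :=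
    hind.card_le_finrank_succ.trans (Nat.add_le_add_right (Submodule.finrank_le _) 1)
  choose y hy hys using fun i => hz (Set.mem_range_self i)
  choose v hv hv' using fun i => exists_rankOne_eq_smul (w i) (y i)
  have hdec : HasDecomp μ A (∑ i, ∏ k, ‖v i k‖) :=
    ⟨v, by rw [← hsum]; exact Finset.sum_congr rfl fun i _ => by rw [hv, hy], rfl⟩
  refine ⟨_, ?_, hdec.fin_of_card_le hcard⟩
  calc ∑ i, ∏ k, ‖v i k‖ ≤ ∑ i, w i * s := Finset.sum_le_sum fun i _ => by
        rw [hv', abs_of_pos (hw i)]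
        exact mul_le_mul_of_nonneg_left (hys i) (hw i).le
    _ = s := by rw [← Finset.sum_mul, hw1, one_mul]

/-- Decompositions with a fixed number of terms pass to the limit. -/
lemma HasDecomp.of_tendsto [Nonempty ι] {κ : Type*} [Fintype κ]
    {X : ℕ → ((k : ι) → Fin (n k)) → ℝ} {s : ℕ → ℝ} {A : ((k : ι) → Fin (n k)) → ℝ} {t : ℝ}
    (h : ∀ m, HasDecomp κ (X m) (s m)) (hX : Tendsto X atTop (𝓝 A))
    (hs : Tendsto s atTop (𝓝 t)) : HasDecomp κ A t := by
  choose x hxA hxs using h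
  choose y hy hyP hyb using fun m i => exists_balanced (x m i)
  obtain ⟨M, hM⟩ := hs.bddAbove_range
  have hbound : ∀ m, y m ∈ Metric.closedBall
      (0 : κ → (k : ι) → EuclideanSpace ℝ (Fin (n k))) (1 + M) := fun m => by
    have hsM : s m ≤ M := hM (Set.mem_range_self m)
    have hle : ∀ i, ∏ k, ‖x m i k‖ ≤ M := fun i => by
      refine le_trans ?_ hsM
      rw [hxs]
      exact Finset.single_le_sum (f := fun i => ∏ k, ‖x m i k‖)
        (fun _ _ => Finset.prod_nonneg fun _ _ => norm_nonneg _) (Finset.mem_univ i)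
    have h0 : 0 ≤ s m := by
      rw [hxs]
      positivity
    have hM0 : 0 ≤ 1 + M := by linarith
    rw [mem_closedBall_zero_iff, pi_norm_le_iff_of_nonneg hM0]
    intro i
    rw [pi_norm_le_iff_of_nonneg hM0]
    exact fun k => (hyb m i k).trans (add_le_add_right (hle i) 1)
  obtain ⟨a, -, φ, hφ, ha⟩ := tendsto_subseq_of_bounded Metric.isBounded_closedBall hbound
  have hcA : Continuous fun y : κ → (k : ι) → EuclideanSpace ℝ (Fin (n k)) =>
      ∑ i, rankOne (y i) :=
    continuous_finsetSum _ fun i _ => continuous_rankOne.comp (continuous_apply i)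
  have hcs : Continuous fun y : κ → (k : ι) → EuclideanSpace ℝ (Fin (n k)) =>
      ∑ i, ∏ k, ‖y i k‖ := by fun_prop
  refine ⟨a, tendsto_nhds_unique (hX.comp hφ.tendsto_atTop) ?_,
    tendsto_nhds_unique (hs.comp hφ.tendsto_atTop) ?_⟩
  · refine ((hcA.tendsto a).comp ha).congr fun m => ?_
    simp [hxA, hy]
  · refine ((hcs.tendsto a).comp ha).congr fun m => ?_
    simp [hxs, hyP]

end Decompositions

section NuclearNorm

open Filter Topology

variable {ι : Type} [Fintype ι] [DecidableEq ι] {n : ι → ℕ}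

lemma nucNorm_le {κ : Type*} [Fintype κ] {A : ((k : ι) → Fin (n k)) → ℝ} {s : ℝ}
    (h : HasDecomp κ A s) : nucNorm A ≤ s := by
  refine csInf_le ⟨0, ?_⟩ ⟨_, h.congr (Fintype.equivFin κ).symm⟩
  rintro t ⟨r, ht⟩
  exact HasDecomp.nonneg (κ := Fin r) ht

/-- The infimum defining the nuclear norm is attained. -/
lemma exists_hasDecomp_nucNorm [Nonempty ι] (A : ((k : ι) → Fin (n k)) → ℝ) :
    ∃ r : ℕ, HasDecomp (Fin r) A (nucNorm A) := by
  have hne : { s : ℝ | ∃ r : ℕ, HasDecomp (Fin r) A s }.Nonempty :=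
    ⟨_, _, (hasDecomp_entries A).congr (Fintype.equivFin _).symm⟩
  have hbdd : BddBelow { s : ℝ | ∃ r : ℕ, HasDecomp (Fin r) A s } :=
    ⟨0, fun s ⟨r, hs⟩ => hs.nonneg⟩
  obtain ⟨u, -, hu, hmem⟩ := exists_seq_tendsto_sInf hne hbdd
  choose r hr using hmem
  choose t htu ht using fun m => (hr m).exists_fin_le
  have hlim : Tendsto t atTop (𝓝 (nucNorm A)) :=
    tendsto_of_tendsto_of_tendsto_of_le_of_le tendsto_const_nhds hu
      (fun m => nucNorm_le (ht m)) htu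
  exact ⟨_, HasDecomp.of_tendsto ht tendsto_const_nhds hlim⟩

lemma nucNorm_add_le [Nonempty ι] (A B : ((k : ι) → Fin (n k)) → ℝ) :
    nucNorm (A + B) ≤ nucNorm A + nucNorm B := by
  obtain ⟨r, hA⟩ := exists_hasDecomp_nucNorm A
  obtain ⟨s, hB⟩ := exists_hasDecomp_nucNorm B
  exact nucNorm_le (hA.add hB)

lemma abs_nucNorm_sub_le [Nonempty ι] (A B : ((k : ι) → Fin (n k)) → ℝ) :
    |nucNorm A - nucNorm B| ≤ ∑ i, |A i - B i| := by
  have key : ∀ A B : ((k : ι) → Fin (n k)) → ℝ,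
      nucNorm A - nucNorm B ≤ ∑ i, |A i - B i| := fun A B => by
    have h1 := nucNorm_add_le (A - B) B
    have h2 := nucNorm_le (hasDecomp_entries (A - B))
    rw [sub_add_cancel] at h1
    simp only [Pi.sub_apply] at h2
    linarith
  refine abs_sub_le_iff.2 ⟨key A B, ?_⟩
  simpa only [abs_sub_comm] using key B A

lemma continuous_nucNorm [Nonempty ι] :
    Continuous (nucNorm : (((k : ι) → Fin (n k)) → ℝ) → ℝ) := by
  refine continuous_iff_continuousAt.2 fun A => tendsto_iff_dist_tendsto_zero.2 ?_
  have hc : Continuous fun B : ((k : ι) → Fin (n k)) → ℝ => ∑ i, |B i - A i| := by fun_prop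
  refine squeeze_zero (fun _ => dist_nonneg) (fun B => abs_nucNorm_sub_le B A) ?_
  simpa using hc.tendsto A

lemma tNuclearRank_le_iff [Nonempty ι] {A : ((k : ι) → Fin (n k)) → ℝ} {r : ℕ} :
    tNuclearRank A ≤ r ↔ HasDecomp (Fin r) A (nucNorm A) := by
  refine ⟨fun h => ?_, fun h => Nat.sInf_le h⟩
  have hmem : HasDecomp (Fin (tNuclearRank A)) A (nucNorm A) :=
    Nat.sInf_mem (s := { r : ℕ | HasDecomp (Fin r) A (nucNorm A) }) (exists_hasDecomp_nucNorm A)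
  exact hmem.fin_of_card_le (by simpa using h)

lemma isClosed_tNuclearRank_le [Nonempty ι] (r : ℕ) :
    IsClosed { A : ((k : ι) → Fin (n k)) → ℝ | tNuclearRank A ≤ r } := by
  refine IsSeqClosed.isClosed fun X A hX hlim => ?_
  exact tNuclearRank_le_iff.2 (HasDecomp.of_tendsto (fun m => tNuclearRank_le_iff.1 (hX m)) hlim
    ((continuous_nucNorm.tendsto A).comp hlim))

lemma tNuclearRank_zero [Nonempty ι] :
    tNuclearRank (0 : ((k : ι) → Fin (n k)) → ℝ) = 0 := by
  obtain ⟨r, h⟩ := exists_hasDecomp_nucNorm (0 : ((k : ι) → Fin (n k)) → ℝ)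
  have h0 : nucNorm (0 : ((k : ι) → Fin (n k)) → ℝ) = 0 :=
    le_antisymm (nucNorm_le (hasDecomp_zero (Fin 0))) h.nonneg
  exact Nat.le_zero.1 (tNuclearRank_le_iff.2 (h0.symm ▸ hasDecomp_zero (Fin 0)))

lemma hsNorm_eq_norm_toLp (A : ((k : ι) → Fin (n k)) → ℝ) :
    hsNorm A = ‖WithLp.toLp 2 A‖ :=
  (EuclideanSpace.norm_eq _).symm

end NuclearNorm

/-- Corollary 4.5: the best nuclear rank-`r` approximation problem always has a solution:
for every real tensor `A` there is a tensor `X` of nuclear rank at most `r` minimizing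
the Hilbert–Schmidt distance `‖A − X‖` among all such tensors. -/
theorem stmt8 {d : ℕ} (hd : 0 < d) {n : Fin d → ℕ}
    (A : ((k : Fin d) → Fin (n k)) → ℝ) (r : ℕ) :
    ∃ X : ((k : Fin d) → Fin (n k)) → ℝ, tNuclearRank X ≤ r ∧
      ∀ Y : ((k : Fin d) → Fin (n k)) → ℝ, tNuclearRank Y ≤ r →
        hsNorm (A - X) ≤ hsNorm (A - Y) := by
  have : Nonempty (Fin d) := ⟨⟨0, hd⟩⟩
  have hclosed : IsClosed {Z : EuclideanSpace ℝ ((k : Fin d) → Fin (n k)) |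
      tNuclearRank Z.ofLp ≤ r} :=
    (isClosed_tNuclearRank_le r).preimage (PiLp.continuous_ofLp 2 _)
  obtain ⟨Z, hZ, hdist⟩ := hclosed.exists_infDist_eq_dist
    ⟨0, by simp [tNuclearRank_zero]⟩ (WithLp.toLp 2 A)
  refine ⟨Z.ofLp, hZ, fun Y hY => ?_⟩
  have h := Metric.infDist_le_dist_of_mem (x := WithLp.toLp 2 A)
    (show WithLp.toLp 2 Y ∈ {Z : EuclideanSpace ℝ ((k : Fin d) → Fin (n k)) |
      tNuclearRank Z.ofLp ≤ r} from hY)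
  rw [hdist, dist_eq_norm, dist_eq_norm] at h
  simpa only [hsNorm_eq_norm_toLp, WithLp.toLp_sub, WithLp.toLp_ofLp] using h
end
end

section
/- Let A ∈ S^d(ℝ^n) be a symmetric d-tensor. Then ‖A‖_{*,ℝ} = min{ Σ_{i=1}^r ‖x_i‖^d : A = Σ_{i=1}^r ε_i x_i^{⊗d}, ε_i ∈ {−1,1}, x_i ∈ ℝ^n, r ∈ ℕ }, where the minimum is over all finite signed symmetric rank-one decompositions of A and is attained. -/
open scoped BigOperators

noncomputable section

open Set in
/-- In finite dimension, the convex hull of a compact set is compact. -/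
theorem IsCompact.convexHull_of_finiteDimensional {E : Type*} [AddCommGroup E] [Module ℝ E]
    [TopologicalSpace E] [IsTopologicalAddGroup E] [ContinuousSMul ℝ E] [FiniteDimensional ℝ E]
    {s : Set E} (hs : IsCompact s) : IsCompact (convexHull ℝ s) := by
  classical
  rcases s.eq_empty_or_nonempty with rfl | ⟨z₀, hz₀⟩
  · simp
  let N := Module.finrank ℝ E + 1
  let F : (Fin N → ℝ) × (Fin N → E) → E := fun p => ∑ i, p.1 i • p.2 i
  have hF : Continuous F := by fun_prop
  have hc : IsCompact ((stdSimplex ℝ (Fin N)) ×ˢ (Set.univ.pi fun _ : Fin N => s)) :=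
    (isCompact_stdSimplex ℝ (Fin N)).prod (isCompact_univ_pi fun _ => hs)
  convert hc.image hF using 1
  apply Subset.antisymm
  · intro x hx
    obtain ⟨ι, _, z, w, hz, hind, hw, hw1, rfl⟩ := eq_pos_convex_span_of_mem_convexHull hx
    have hcard : Fintype.card ι ≤ Fintype.card (Fin N) := by
      have h := hind.card_le_finrank_succ
      have h' := Submodule.finrank_le (vectorSpan ℝ (range z))
      simp only [Fintype.card_fin, N]
      omega
    obtain ⟨e⟩ := Function.Embedding.nonempty_of_card_le hcard
    refine ⟨(Function.extend e w 0, Function.extend e z fun _ => z₀), ⟨⟨?_, ?_⟩, ?_⟩, ?_⟩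
    · intro j
      by_cases hj : ∃ i, e i = j
      · obtain ⟨i, rfl⟩ := hj
        simpa [e.injective.extend_apply] using (hw i).le
      · simp [Function.extend_apply' _ _ _ hj]
    · rw [← hw1]
      exact (Fintype.sum_of_injective e e.injective _ _
        (fun j hj => by simp [Function.extend_apply' _ _ _ hj])
        fun i => (e.injective.extend_apply _ _ _).symm).symm
    · intro j _
      by_cases hj : ∃ i, e i = j
      · obtain ⟨i, rfl⟩ := hj
        simpa [e.injective.extend_apply] using hz ⟨i, rfl⟩
      · simpa [Function.extend_apply' _ _ _ hj] using hz₀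
    · exact (Fintype.sum_of_injective e e.injective _ _
        (fun j hj => by simp [Function.extend_apply' _ _ _ hj])
        fun i => by simp [e.injective.extend_apply]).symm
  · rintro _ ⟨⟨w, z⟩, ⟨⟨hw0, hw1⟩, hz⟩, rfl⟩
    exact mem_convexHull_of_exists_fintype w z hw0 hw1 (fun i => hz i (mem_univ i)) rfl

/-- A symmetric bilinear function that is bounded by `M` on the unit sphere and attains `M` at
`(x, y)` also attains it at the normalized midpoint of `x` and `y`. -/
theorem abs_eq_of_midpoint {E : Type*} [NormedAddCommGroup E] [InnerProductSpace ℝ E]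
    (B : E →ₗ[ℝ] E →ₗ[ℝ] ℝ) (hB : ∀ x y, B x y = B y x) {M : ℝ}
    (hM : ∀ x y, ‖x‖ = 1 → ‖y‖ = 1 → |B x y| ≤ M) {x y : E} (hx : ‖x‖ = 1) (hy : ‖y‖ = 1)
    (hxy : |B x y| = M) (h0 : x + y ≠ 0) :
    |B (‖x + y‖⁻¹ • (x + y)) (‖x + y‖⁻¹ • (x + y))| = M := by
  have hbound (v : E) : |B v v| ≤ M * ‖v‖ ^ 2 := by
    rcases eq_or_ne v 0 with rfl | hv
    · simp
    have hv' : 0 < ‖v‖ := norm_pos_iff.2 hv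
    have hn : ‖‖v‖⁻¹ • v‖ = 1 := by rw [norm_smul, norm_inv, norm_norm, inv_mul_cancel₀ hv'.ne']
    have h := hM _ _ hn hn
    simp only [map_smul, LinearMap.smul_apply, smul_eq_mul, abs_mul, abs_inv, abs_norm] at h
    rw [← mul_assoc, ← mul_inv, inv_mul_le_iff₀ (by positivity)] at h
    nlinarith
  have hpos : 0 < ‖x + y‖ := norm_pos_iff.2 h0
  have hid : B (x + y) (x + y) - B (x - y) (x - y) = 4 * B x y := by
    simp only [map_add, map_sub, LinearMap.add_apply, LinearMap.sub_apply, hB y x]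
    ring
  have hpar := parallelogram_law_with_norm ℝ x y
  rw [hx, hy] at hpar
  have h1 := hbound (x + y)
  have h2 := hbound (x - y)
  have h3 : 4 * M ≤ |B (x + y) (x + y)| + |B (x - y) (x - y)| := by
    rw [← hxy, show 4 * |B x y| = |4 * B x y| by simp [abs_mul], ← hid]
    exact abs_sub _ _
  have h4 : |B (x + y) (x + y)| = M * ‖x + y‖ ^ 2 := by
    have h5 : M * (‖x + y‖ ^ 2 + ‖x - y‖ ^ 2) = 4 * M := by rw [hpar]; ring
    linarith
  simp only [map_smul, LinearMap.smul_apply, smul_eq_mul, abs_mul, abs_inv, abs_norm, h4]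
  field_simp

open Function in
/-- Banach's theorem: on a finite-dimensional real inner product space, a symmetric multilinear
form attains its norm at a diagonal tuple. -/
theorem MultilinearMap.exists_abs_le_diagonal {E ι : Type*} [NormedAddCommGroup E]
    [InnerProductSpace ℝ E] [FiniteDimensional ℝ E] [Fintype ι] [DecidableEq ι] [Nonempty ι]
    (T : MultilinearMap ℝ (fun _ : ι => E) ℝ) (hc : Continuous T)
    (hT : ∀ (σ : Equiv.Perm ι) (x : ι → E), T (x ∘ σ) = T x)
    (x : ι → E) (hx : ∀ i, ‖x i‖ = 1) :
    ∃ u : E, ‖u‖ = 1 ∧ |T x| ≤ |T fun _ => u| := by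
  let S : Set (ι → E) := Set.univ.pi fun _ => Metric.sphere 0 1
  have hSmem (z : ι → E) : z ∈ S ↔ ∀ i, ‖z i‖ = 1 := by simp [S, Set.mem_pi]
  have hS : IsCompact S := isCompact_univ_pi fun _ => isCompact_sphere 0 1
  obtain ⟨a, haS, ha⟩ := hS.exists_isMaxOn ⟨x, (hSmem x).2 hx⟩ hc.abs.continuousOn
  have hM (z : ι → E) (hz : z ∈ S) : |T z| ≤ |T a| := ha hz
  let S' : Set (ι → E) := S ∩ {z | |T z| = |T a|}
  have hS' : IsCompact S' := hS.inter_right (isClosed_eq hc.abs continuous_const)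
  obtain ⟨y, ⟨hyS, hyT⟩, hy⟩ := hS'.exists_isMaxOn (f := fun z => ‖∑ i, z i‖) ⟨a, haS, rfl⟩
    (by fun_prop)
  simp only [Set.mem_ofPred_eq] at hyT
  have hmax (z : ι → E) (hz : ∀ i, ‖z i‖ = 1) (hzT : |T z| = |T a|) :
      ‖∑ i, z i‖ ≤ ‖∑ i, y i‖ := hy ⟨(hSmem z).2 hz, hzT⟩
  have hy1 := (hSmem y).1 hyS
  have hupd (z : ι → E) (i : ι) (v : E) : ∑ k, update z i v k = ∑ k, z k + (v - z i) := by
    rw [Finset.sum_update_of_mem (Finset.mem_univ i),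
      ← Finset.add_sum_erase Finset.univ z (Finset.mem_univ i), Finset.sdiff_singleton_eq_erase]
    abel
  set s := ∑ i, y i with hs
  have hinner (i : ι) : 0 < inner ℝ (y i) s := by
    have h := hmax (update y i (-y i))
      (fun k => by by_cases hk : k = i <;> simp [hk, hy1])
      (by
        rw [show -y i = (-1 : ℝ) • y i by simp, T.map_update_smul, update_eq_self]
        simpa using hyT)
    rw [hupd, ← hs] at h
    have h' : ‖s + (-y i - y i)‖ ^ 2 ≤ ‖s‖ ^ 2 := by gcongr
    rw [show s + (-y i - y i) = s - (2 : ℝ) • y i by rw [two_smul]; abel,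
      norm_sub_sq_real, norm_smul, inner_smul_right, hy1, real_inner_comm] at h'
    norm_num at h'
    linarith
  have hall (i j : ι) : y i = y j := by
    by_contra hij
    have hne : i ≠ j := fun h => hij (by rw [h])
    have hadd : 0 < inner ℝ (y i + y j) s := by
      rw [inner_add_left]; exact add_pos (hinner i) (hinner j)
    have h0 : y i + y j ≠ 0 := by
      intro h; rw [h, inner_zero_left] at hadd; exact hadd.false
    have hpos : 0 < ‖y i + y j‖ := norm_pos_iff.2 h0
    let B : E →ₗ[ℝ] E →ₗ[ℝ] ℝ := LinearMap.mk₂ ℝ (fun v w => T (update (update y i v) j w))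
      (fun v v' w => by
        simp only [update_comm hne, T.map_update_add])
      (fun c v w => by
        simp only [update_comm hne, T.map_update_smul])
      (fun v w w' => by simp only [T.map_update_add])
      (fun c v w => by simp only [T.map_update_smul])
    have hBapp (v w : E) : B v w = T (update (update y i v) j w) := rfl
    have hsymB (v w : E) : B v w = B w v := by
      rw [hBapp, hBapp, ← hT (Equiv.swap i j)]
      congr 1
      ext1 k
      by_cases hki : k = i
      · subst hki; simp [hne]
      by_cases hkj : k = j
      · subst hkj; simp [hne]
      simp [Equiv.swap_apply_of_ne_of_ne hki hkj, hki, hkj]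
    have hunit (v w : E) (hv : ‖v‖ = 1) (hw : ‖w‖ = 1) (k : ι) :
        ‖update (update y i v) j w k‖ = 1 := by
      by_cases hkj : k = j
      · simp [hkj, hw]
      by_cases hki : k = i <;> simp [hkj, hki, hne, hv, hy1]
    have hBy : B (y i) (y j) = T y := by simp [hBapp]
    set u := ‖y i + y j‖⁻¹ • (y i + y j) with hu
    have hu1 : ‖u‖ = 1 := by rw [hu, norm_smul, norm_inv, norm_norm, inv_mul_cancel₀ hpos.ne']
    have hmid : |B u u| = |T a| := abs_eq_of_midpoint B hsymB
      (fun v w hv hw => hM _ ((hSmem _).2 (hunit v w hv hw))) (hy1 i) (hy1 j)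
      (by rw [hBy, hyT]) h0
    have hle := hmax _ (hunit u u hu1 hu1) hmid
    rw [hupd, hupd, update_of_ne hne.symm, ← hs] at hle
    have hlt : ‖y i + y j‖ < 2 := by
      have hsub : 0 < ‖y i - y j‖ := norm_pos_iff.2 (sub_ne_zero.2 hij)
      have hpar := parallelogram_law_with_norm ℝ (y i) (y j)
      rw [hy1, hy1] at hpar
      nlinarith
    have hc0 : 0 < 2 * ‖y i + y j‖⁻¹ - 1 := by
      rw [sub_pos, ← div_eq_mul_inv, lt_div_iff₀ hpos]; linarith
    have hform : s + (u - y i) + (u - y j) = s + (2 * ‖y i + y j‖⁻¹ - 1) • (y i + y j) := by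
      rw [hu]; module
    have hle' : ‖s + (u - y i) + (u - y j)‖ ^ 2 ≤ ‖s‖ ^ 2 := by gcongr
    rw [hform, norm_add_sq_real, inner_smul_right, real_inner_comm] at hle'
    have := mul_pos hc0 hadd
    nlinarith [sq_nonneg ‖(2 * ‖y i + y j‖⁻¹ - 1) • (y i + y j)‖]
  obtain ⟨i₀⟩ := ‹Nonempty ι›
  refine ⟨y i₀, hy1 i₀, ?_⟩
  rw [show (fun _ => y i₀) = y from funext fun j => hall i₀ j, hyT]
  exact hM x ((hSmem x).2 hx)

/-- The tensor product map `rankOne` as a multilinear map. -/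
def rankOneMultilinear (d n : ℕ) :
    MultilinearMap ℝ (fun _ : Fin d => EuclideanSpace ℝ (Fin n)) ((Fin d → Fin n) → ℝ) :=
  MultilinearMap.pi fun i => (MultilinearMap.mkPiAlgebra ℝ (Fin d) ℝ).compLinearMap
    fun k => (EuclideanSpace.proj (i k)).toLinearMap

theorem rankOneMultilinear_apply {d n : ℕ} (x : Fin d → EuclideanSpace ℝ (Fin n)) :
    rankOneMultilinear d n x = rankOne x := by
  ext i
  simp [rankOneMultilinear, rankOne]

theorem continuous_rankOne_s9 {d n : ℕ} :
    Continuous fun x : Fin d → EuclideanSpace ℝ (Fin n) => rankOne x := by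
  unfold rankOne
  fun_prop

/-- The projection of a tensor onto its symmetric part. -/
def symPart (d n : ℕ) : ((Fin d → Fin n) → ℝ) →ₗ[ℝ] ((Fin d → Fin n) → ℝ) :=
  ((d.factorial : ℝ)⁻¹) • ∑ σ : Equiv.Perm (Fin d), LinearMap.funLeft ℝ ℝ fun i => i ∘ σ

theorem symPart_apply {d n : ℕ} (A : (Fin d → Fin n) → ℝ) (i : Fin d → Fin n) :
    symPart d n A i = (d.factorial : ℝ)⁻¹ * ∑ σ : Equiv.Perm (Fin d), A (i ∘ σ) := by
  simp [symPart, LinearMap.funLeft_apply]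

theorem symPart_of_symmetric {d n : ℕ} {A : (Fin d → Fin n) → ℝ}
    (hA : ∀ (σ : Equiv.Perm (Fin d)) (i : Fin d → Fin n), A (i ∘ σ) = A i) :
    symPart d n A = A := by
  ext i
  have : (d.factorial : ℝ) ≠ 0 := by exact_mod_cast d.factorial_ne_zero
  simp [symPart_apply, hA, Fintype.card_perm, this]

theorem rankOne_comp_perm {d n : ℕ} (x : Fin d → EuclideanSpace ℝ (Fin n))
    (σ : Equiv.Perm (Fin d)) (i : Fin d → Fin n) :
    rankOne (x ∘ σ) (i ∘ σ) = rankOne x i :=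
  Equiv.prod_comp σ fun k => x k (i k)

theorem symPart_rankOne_comp_perm {d n : ℕ} (x : Fin d → EuclideanSpace ℝ (Fin n))
    (σ : Equiv.Perm (Fin d)) :
    symPart d n (rankOne (x ∘ σ)) = symPart d n (rankOne x) := by
  ext i
  rw [symPart_apply, symPart_apply]
  congr 1
  refine Fintype.sum_equiv (Equiv.mulRight σ⁻¹) _ _ fun τ => ?_
  rw [← rankOne_comp_perm x σ]
  congr 1
  ext k
  simp

theorem symPart_rankOne_const {d n : ℕ} (u : EuclideanSpace ℝ (Fin n)) :
    symPart d n (rankOne fun _ => u) = rankOne fun _ => u :=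
  symPart_of_symmetric fun σ i => rankOne_comp_perm (fun _ => u) σ i

/-- The convex hull of the signed symmetric rank-one tensors with factors in the unit ball. -/
def symBall (d n : ℕ) : Set ((Fin d → Fin n) → ℝ) :=
  convexHull ℝ ((fun p : ℝ × EuclideanSpace ℝ (Fin n) => p.1 • rankOne fun _ : Fin d => p.2) ''
    (({1, -1} : Set ℝ) ×ˢ Metric.closedBall 0 1))

theorem smul_rankOne_mem_symBall {d n : ℕ} {ε : ℝ} (hε : ε = 1 ∨ ε = -1)
    {u : EuclideanSpace ℝ (Fin n)} (hu : ‖u‖ ≤ 1) :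
    (ε • rankOne fun _ : Fin d => u) ∈ symBall d n :=
  subset_convexHull ℝ _ ⟨(ε, u), ⟨by simpa using hε, by simpa using hu⟩, rfl⟩

theorem isCompact_symBall (d n : ℕ) : IsCompact (symBall d n) := by
  refine IsCompact.convexHull_of_finiteDimensional
    (((Set.toFinite _).isCompact.prod (isCompact_closedBall 0 1)).image ?_)
  exact continuous_fst.smul
    (continuous_rankOne_s9.comp (continuous_pi fun _ : Fin d => continuous_snd))

theorem symPart_rankOne_mem_symBall {d n : ℕ} (hd : 0 < d)
    (x : Fin d → EuclideanSpace ℝ (Fin n)) (hx : ∀ k, ‖x k‖ = 1) :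
    symPart d n (rankOne x) ∈ symBall d n := by
  by_contra hmem
  obtain ⟨f, c, hfc, hcf⟩ := geometric_hahn_banach_closed_point (convex_convexHull ℝ _)
    (isCompact_symBall d n).isClosed hmem
  have : Nonempty (Fin d) := ⟨⟨0, hd⟩⟩
  let T := (f.toLinearMap ∘ₗ symPart d n).compMultilinearMap (rankOneMultilinear d n)
  have hTapp (z : Fin d → EuclideanSpace ℝ (Fin n)) : T z = f (symPart d n (rankOne z)) := by
    simp [T, rankOneMultilinear_apply]
  have hcont : Continuous T := by
    simp only [funext hTapp]
    exact f.continuous.comp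
      ((LinearMap.continuous_of_finiteDimensional (symPart d n)).comp continuous_rankOne_s9)
  obtain ⟨u, hu, hle⟩ := T.exists_abs_le_diagonal hcont
    (fun σ z => by rw [hTapp, hTapp, symPart_rankOne_comp_perm]) x hx
  rw [hTapp, hTapp, symPart_rankOne_const] at hle
  have h1 := hfc _ (smul_rankOne_mem_symBall (d := d) (Or.inl rfl) hu.le)
  have h2 := hfc _ (smul_rankOne_mem_symBall (d := d) (Or.inr rfl) hu.le)
  rw [map_smul, smul_eq_mul] at h1 h2
  have h3 : |f (rankOne fun _ => u)| < c := abs_lt.2 ⟨by linarith, by linarith⟩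
  linarith [le_abs_self (f (symPart d n (rankOne x)))]

theorem exists_symPart_rankOne_eq_smul {d n : ℕ} (hd : 0 < d)
    (x : Fin d → EuclideanSpace ℝ (Fin n)) :
    ∃ k ∈ symBall d n, symPart d n (rankOne x) = (∏ j, ‖x j‖) • k := by
  by_cases h0 : ∃ j, x j = 0
  · obtain ⟨j, hj⟩ := h0
    refine ⟨_, smul_rankOne_mem_symBall (u := 0) (Or.inl rfl) (by simp), ?_⟩
    rw [← rankOneMultilinear_apply, (rankOneMultilinear d n).map_coord_zero j hj, map_zero,
      Finset.prod_eq_zero (Finset.mem_univ j) (by simp [hj]), zero_smul]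
  · push Not at h0
    have hpos (j : Fin d) : ‖x j‖ ≠ 0 := norm_ne_zero_iff.2 (h0 j)
    refine ⟨_, symPart_rankOne_mem_symBall hd (fun j => ‖x j‖⁻¹ • x j) fun j => ?_, ?_⟩
    · rw [norm_smul, norm_inv, norm_norm, inv_mul_cancel₀ (hpos j)]
    · rw [← map_smul, ← rankOneMultilinear_apply, ← rankOneMultilinear_apply,
        ← MultilinearMap.map_smul_univ]
      simp [smul_smul, hpos]

theorem Convex.exists_sum_smul_eq_smul {ι E : Type*} [Fintype ι] [AddCommGroup E] [Module ℝ E]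
    {K : Set E} (hK : Convex ℝ K) (hne : K.Nonempty) (c : ι → ℝ) (hc : ∀ i, 0 ≤ c i)
    (k : ι → E) (hk : ∀ i, k i ∈ K) : ∃ z ∈ K, ∑ i, c i • k i = (∑ i, c i) • z := by
  rcases (Finset.sum_nonneg fun i (_ : i ∈ Finset.univ) => hc i).eq_or_lt with h | h
  · obtain ⟨z, hz⟩ := hne
    refine ⟨z, hz, ?_⟩
    have h0 := (Finset.sum_eq_zero_iff_of_nonneg fun i _ => hc i).1 h.symm
    rw [← h, zero_smul]
    exact Finset.sum_eq_zero fun i hi => by rw [h0 i hi, zero_smul]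
  · refine ⟨Finset.univ.centerMass c k, hK.centerMass_mem (fun i _ => hc i) h fun i _ => hk i, ?_⟩
    rw [Finset.centerMass, smul_smul, mul_inv_cancel₀ h.ne', one_smul]

/-- Every tensor has a decomposition into rank-one tensors. -/
theorem exists_eq_sum_rankOne {d n : ℕ} (hd : 0 < d) (A : (Fin d → Fin n) → ℝ) :
    ∃ (r : ℕ) (x : Fin r → Fin d → EuclideanSpace ℝ (Fin n)), A = ∑ i, rankOne (x i) := by
  let e := Fintype.equivFin (Fin d → Fin n)
  let y (i : Fin d → Fin n) (k : Fin d) : EuclideanSpace ℝ (Fin n) :=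
    (if k = ⟨0, hd⟩ then A i else 1) • EuclideanSpace.single (i k) 1
  refine ⟨_, fun j => y (e.symm j), ?_⟩
  rw [Equiv.sum_comp e.symm fun i => rankOne (y i)]
  ext j
  have hy (i : Fin d → Fin n) : rankOne (y i) j = if j = i then A i else 0 := by
    simp only [rankOne, y, PiLp.smul_apply, smul_eq_mul, Finset.prod_mul_distrib,
      Finset.prod_ite_eq', Finset.mem_univ, if_true]
    split_ifs with h
    · subst h; simp
    · obtain ⟨k, hk⟩ := Function.ne_iff.1 h
      rw [Finset.prod_eq_zero (Finset.mem_univ k) (by simp [hk]), mul_zero]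
  simp [Finset.sum_apply, hy]

theorem bddBelow_nucNorm {d n : ℕ} (A : (Fin d → Fin n) → ℝ) :
    BddBelow { s : ℝ | ∃ (r : ℕ) (x : Fin r → Fin d → EuclideanSpace ℝ (Fin n)),
      A = (∑ i, rankOne (x i)) ∧ s = ∑ i, ∏ k, ‖x i k‖ } := by
  refine ⟨0, ?_⟩
  rintro _ ⟨r, x, -, rfl⟩
  positivity

theorem exists_mem_symBall_eq_nucNorm_smul {d n : ℕ} (hd : 0 < d) {A : (Fin d → Fin n) → ℝ}
    (hsymm : ∀ (σ : Equiv.Perm (Fin d)) (i : Fin d → Fin n), A (i ∘ σ) = A i) :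
    ∃ k ∈ symBall d n, nucNorm A • k = A := by
  have hK : CompactSpace (symBall d n) := isCompact_iff_compactSpace.1 (isCompact_symBall d n)
  have hclosed : IsClosed (Prod.fst '' {p : ℝ × symBall d n | p.1 • (p.2 : _ → ℝ) = A}) :=
    isClosedMap_fst_of_compactSpace _ (isClosed_eq (by fun_prop) continuous_const)
  have hne : (symBall d n).Nonempty :=
    ⟨_, smul_rankOne_mem_symBall (u := 0) (Or.inl rfl) (by simp)⟩
  obtain ⟨r₀, x₀, hx₀⟩ := exists_eq_sum_rankOne hd A
  have hmem := csInf_mem_closure (s := { s : ℝ | ∃ (r : ℕ)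
      (x : Fin r → Fin d → EuclideanSpace ℝ (Fin n)),
      A = (∑ i, rankOne (x i)) ∧ s = ∑ i, ∏ k, ‖x i k‖ })
    ⟨_, r₀, x₀, hx₀, rfl⟩ (bddBelow_nucNorm A)
  have hsub := closure_minimal (t := Prod.fst '' {p : ℝ × symBall d n | p.1 • (p.2 : _ → ℝ) = A})
    ?_ hclosed hmem
  · obtain ⟨⟨t, k⟩, hk, ht⟩ := hsub
    subst ht
    exact ⟨k, k.2, hk⟩
  · rintro _ ⟨r, x, hA, rfl⟩
    choose k hk hxk using fun i => exists_symPart_rankOne_eq_smul hd (x i)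
    obtain ⟨z, hz, hsum⟩ := (convex_convexHull ℝ _).exists_sum_smul_eq_smul hne
      (fun i => ∏ j, ‖x i j‖) (fun i => by positivity) k hk
    refine ⟨(∑ i, ∏ j, ‖x i j‖, ⟨z, hz⟩), ?_, rfl⟩
    change (∑ i, ∏ j, ‖x i j‖) • z = A
    rw [← hsum, ← symPart_of_symmetric hsymm, hA, map_sum]
    exact Finset.sum_congr rfl fun i _ => (hxk i).symm

theorem nucNorm_nonneg {d n : ℕ} (A : (Fin d → Fin n) → ℝ) : 0 ≤ nucNorm A := by
  refine Real.sInf_nonneg ?_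
  rintro _ ⟨r, x, -, rfl⟩
  positivity

theorem nucNorm_le_of_symmetric_decomposition {d n r : ℕ} (hd : 0 < d)
    {A : (Fin d → Fin n) → ℝ} (ε : Fin r → ℝ) (x : Fin r → EuclideanSpace ℝ (Fin n))
    (hε : ∀ i, ε i = 1 ∨ ε i = -1) (hA : A = ∑ i, ε i • rankOne fun _ : Fin d => x i) :
    nucNorm A ≤ ∑ i, ‖x i‖ ^ d := by
  refine csInf_le (bddBelow_nucNorm A)
    ⟨r, fun i k => (if k = ⟨0, hd⟩ then ε i else 1) • x i, ?_, ?_⟩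
  · rw [hA]
    refine Finset.sum_congr rfl fun i _ => ?_
    rw [← rankOneMultilinear_apply, ← rankOneMultilinear_apply, MultilinearMap.map_smul_univ]
    simp
  · refine Finset.sum_congr rfl fun i _ => ?_
    have h : |ε i| = 1 := by rcases hε i with h | h <;> simp [h]
    simp [norm_smul, apply_ite, h]

/-- Theorem 5.1: for a symmetric real `d`-tensor `A`, the nuclear norm equals the minimum
of `Σ ‖x_i‖^d` over all signed symmetric rank-one decompositions
`A = Σ ε_i x_i^{⊗d}`, `ε_i ∈ {−1, 1}`, and the minimum is attained. -/
theorem stmt9 {d n : ℕ} (hd : 0 < d) (A : (Fin d → Fin n) → ℝ)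
    (hsymm : ∀ (σ : Equiv.Perm (Fin d)) (i : Fin d → Fin n), A (i ∘ σ) = A i) :
    IsLeast { s : ℝ | ∃ (r : ℕ) (ε : Fin r → ℝ) (x : Fin r → EuclideanSpace ℝ (Fin n)),
      (∀ i, ε i = 1 ∨ ε i = -1) ∧
      A = (∑ i, ε i • rankOne (fun _ : Fin d => x i)) ∧
      s = ∑ i, ‖x i‖ ^ d } (nucNorm A) := by
  constructor
  · obtain ⟨k, hk, hkA⟩ := exists_mem_symBall_eq_nucNorm_smul hd hsymm
    obtain ⟨ι, _, w, z, hw0, hw1, hz, rfl⟩ := mem_convexHull_iff_exists_fintype.1 hk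
    choose p hp hpz using hz
    have hd0 : d ≠ 0 := hd.ne'
    let e := Fintype.equivFin ι
    let c (i : ι) : ℝ := (nucNorm A * w i) ^ (d : ℝ)⁻¹
    have hc0 (i : ι) : 0 ≤ c i := Real.rpow_nonneg (mul_nonneg (nucNorm_nonneg A) (hw0 i)) _
    have hc (i : ι) : c i ^ d = nucNorm A * w i :=
      Real.rpow_inv_natCast_pow (mul_nonneg (nucNorm_nonneg A) (hw0 i)) hd0
    have hε (i : ι) : (p i).1 = 1 ∨ (p i).1 = -1 := by simpa using (hp i).1
    have hdec : A = ∑ j, (p (e.symm j)).1 •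
        rankOne fun _ : Fin d => c (e.symm j) • (p (e.symm j)).2 := by
      rw [Equiv.sum_comp e.symm fun i => (p i).1 • rankOne fun _ : Fin d => c i • (p i).2,
        ← hkA, Finset.smul_sum]
      refine Finset.sum_congr rfl fun i _ => ?_
      simp only [← hpz, ← rankOneMultilinear_apply, MultilinearMap.map_smul_univ,
        Finset.prod_const, Finset.card_univ, Fintype.card_fin, hc, smul_smul]
      congr 1
      ring
    refine ⟨_, _, _, fun j => hε (e.symm j), hdec, le_antisymm
      (nucNorm_le_of_symmetric_decomposition hd _ _ (fun j => hε (e.symm j)) hdec) ?_⟩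
    rw [Equiv.sum_comp e.symm fun i => ‖c i • (p i).2‖ ^ d]
    calc ∑ i, ‖c i • (p i).2‖ ^ d ≤ ∑ i, nucNorm A * w i := by
          refine Finset.sum_le_sum fun i _ => ?_
          have h : ‖(p i).2‖ ≤ 1 := by simpa using (hp i).2
          rw [norm_smul, Real.norm_of_nonneg (hc0 i), mul_pow, hc]
          exact mul_le_of_le_one_right (mul_nonneg (nucNorm_nonneg A) (hw0 i))
            (pow_le_one₀ (norm_nonneg _) h)
      _ = nucNorm A := by rw [← Finset.mul_sum, hw1, mul_one]
  · rintro _ ⟨r, ε, x, hε, hA, rfl⟩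
    exact nucNorm_le_of_symmetric_decomposition hd ε x hε hA
end
end
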